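/- arXiv:2401.04638 — 6 statements merged into one kernel-verified Lean document; each statement's English description precedes it below -/
import Mathlib

section
/- Consider an instance (V,E,ℰ,c,D) of the min-congestion reconfigurable network problem under splittable and segregated routing. Suppose there exist a real λ ≥ 0, reals z_{i,j} ∈ [0,1] for all ordered pairs of distinct nodes with z_{i,j} = z_{j,i} for all i,j, with Σ_j z_{i,j} ≤ 1 for every node v_i, and with z_{i,j}·d_{i,j} ≤ λ·c((v_i,v_j)) for every directed reconfigurable link (v_i,v_j), together with, for each ordered pair (i,j), a nonnegative flow f_{i,j} on the directed static links of E that satisfies flow conservation at every node other than v_i and v_j and sends a net flow of at least (1−z_{i,j})·d_{i,j} units from v_i to v_j, such that Σ_{i,j} f_{i,j}(e) ≤ λ·c(e) for every directed static link e. Then there exists a matching M ⊆ ℰ and a segregated splittable flow serving D in N(M) whose congestion is at most 2λ. In particular, the optimal congestion under splittable segregated routing is at most twice the optimal value of the LP relaxation of the problem's mixed-integer program. -/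
open Finset

namespace MCRN

/-- A directed link of a reconfigurable network: either a direction of a bidirected
static link (indexed by `E × Bool`) or a directed reconfigurable link `(i, j)`. -/
abbrev SLink (V E : Type*) := (E × Bool) ⊕ (V × V)

variable {V E : Type*}

/-- Tail of a directed link. -/
def tl (src tgt : E → V) : SLink V E → V
  | .inl (e, b) => if b then src e else tgt e
  | .inr (i, _) => i

/-- Head of a directed link. -/
def hd (src tgt : E → V) : SLink V E → V
  | .inl (e, b) => if b then tgt e else src e
  | .inr (_, j) => j

variable [Fintype V] [DecidableEq V] [Fintype E] [DecidableEq E]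

/-- Net outflow of `g` at node `v`. -/
def netOut (src tgt : E → V) (g : SLink V E → ℝ) (v : V) : ℝ :=
  (∑ a : SLink V E, if tl src tgt a = v then g a else 0)
    - ∑ a : SLink V E, if hd src tgt a = v then g a else 0

/-- A matching: a set of non-diagonal unordered pairs, no two sharing an endpoint. -/
def IsMatching (M : Finset (Sym2 V)) : Prop :=
  (∀ p ∈ M, ¬ p.IsDiag) ∧ ∀ p ∈ M, ∀ q ∈ M, ∀ v : V, v ∈ p → v ∈ q → p = q

/-- A splittable flow serving demands `D` in the reconfigured network `N(M)`:
nonnegative, supported on static links and reconfigurable links of `M`,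
conserved away from endpoints, and sending net flow `D i j` from `i` to `j`. -/
structure IsFlow (src tgt : E → V) (D : V → V → ℝ) (M : Finset (Sym2 V))
    (f : V → V → SLink V E → ℝ) : Prop where
  nonneg : ∀ i j a, 0 ≤ f i j a
  supp : ∀ i j p q, s(p, q) ∉ M → f i j (Sum.inr (p, q)) = 0
  diag : ∀ i a, f i i a = 0
  conserve : ∀ i j v, v ≠ i → v ≠ j → netOut src tgt (f i j) v = 0
  demand : ∀ i j, i ≠ j → netOut src tgt (f i j) i = D i j

/-- A flow is segregated if each positive demand is carried either entirely by the
single directed reconfigurable link `(i, j)` or only by directed static links. -/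
def Segregated (D : V → V → ℝ) (f : V → V → SLink V E → ℝ) : Prop :=
  ∀ i j, 0 < D i j →
    (∀ a : SLink V E, a ≠ Sum.inr (i, j) → f i j a = 0) ∨
    ∀ p q : V, f i j (Sum.inr (p, q)) = 0

/-- Total flow on a directed link. -/
def totalFlow (f : V → V → SLink V E → ℝ) (a : SLink V E) : ℝ := ∑ i, ∑ j, f i j a

/-- The congestion (maximum load) of the flow `f` in `N(M)` is at most `lam`. -/
def CongLE (c : SLink V E → ℝ) (M : Finset (Sym2 V)) (f : V → V → SLink V E → ℝ)
    (lam : ℝ) : Prop :=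
  (∀ (e : E) (b : Bool), totalFlow f (Sum.inl (e, b)) ≤ lam * c (Sum.inl (e, b))) ∧
  ∀ p q : V, s(p, q) ∈ M → totalFlow f (Sum.inr (p, q)) ≤ lam * c (Sum.inr (p, q))

/-- The congestion (maximum load) of the flow `f` in `N(M)` is at least `lam`:
some existing directed link has load at least `lam`. -/
def CongGE (c : SLink V E → ℝ) (M : Finset (Sym2 V)) (f : V → V → SLink V E → ℝ)
    (lam : ℝ) : Prop :=
  (∃ (e : E) (b : Bool), lam * c (Sum.inl (e, b)) ≤ totalFlow f (Sum.inl (e, b))) ∨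
  ∃ p q : V, s(p, q) ∈ M ∧ lam * c (Sum.inr (p, q)) ≤ totalFlow f (Sum.inr (p, q))

/-- A (nonempty, repetition-free) directed path from `i` to `j`. -/
def IsDiPath (src tgt : E → V) (i j : V) (P : List (SLink V E)) : Prop :=
  P ≠ [] ∧ P.Nodup ∧ P.Chain' (fun a b => hd src tgt a = tl src tgt b) ∧
    P.head?.map (tl src tgt) = some i ∧ P.getLast?.map (hd src tgt) = some j

/-- The flow is unsplittable: each positive demand is routed along a single directed path. -/
def Unsplittable (src tgt : E → V) (D : V → V → ℝ) (f : V → V → SLink V E → ℝ) : Prop :=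
  ∀ i j, 0 < D i j → ∃ P : List (SLink V E), IsDiPath src tgt i j P ∧
    (∀ a ∈ P, f i j a = D i j) ∧ ∀ a : SLink V E, a ∉ P → f i j a = 0

end MCRN

namespace MCRN

/-- Net outflow is homogeneous. -/
lemma netOut_const_mul {V E : Type*} [Fintype V] [DecidableEq V] [Fintype E]
    (src tgt : E → V) (t : ℝ) (g : SLink V E → ℝ) (v : V) :
    netOut src tgt (fun a => t * g a) v = t * netOut src tgt g v := by
  simp only [netOut, mul_sub, Finset.mul_sum, mul_ite, mul_zero]

/-- Net outflow of a flow supported on a single directed link. -/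
lemma netOut_single {V E : Type*} [Fintype V] [DecidableEq V] [Fintype E] [DecidableEq E]
    (src tgt : E → V) (b : SLink V E) (d : ℝ) (v : V) :
    netOut src tgt (fun a => if a = b then d else 0) v =
      (if tl src tgt b = v then d else 0) - if hd src tgt b = v then d else 0 := by
  have key : ∀ P : SLink V E → V,
      (∑ a : SLink V E, if P a = v then (if a = b then d else 0) else 0) =
        if P b = v then d else 0 := by
    intro P
    rw [Finset.sum_eq_single b]
    · simp
    · intro a _ hab
      simp [hab]
    · simp
  rw [netOut, key, key]

/-- The unordered pairs of nodes whose weight exceeds one half. -/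
noncomputable def heavyPairs {V : Type*} [Fintype V] [DecidableEq V] (z : V → V → ℝ) :
    Finset (Sym2 V) :=
  (Finset.univ.filter fun p : V × V => 1 / 2 < z p.1 p.2).image fun p => s(p.1, p.2)

lemma mk_mem_heavyPairs {V : Type*} [Fintype V] [DecidableEq V] {z : V → V → ℝ}
    (hzsym : ∀ i j, z i j = z j i) (p q : V) :
    s(p, q) ∈ heavyPairs z ↔ 1 / 2 < z p q := by
  simp only [heavyPairs, Finset.mem_image, Finset.mem_filter, Finset.mem_univ, true_and,
    Prod.exists, Sym2.eq_iff]
  constructor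
  · rintro ⟨a, b, h, ⟨rfl, rfl⟩ | ⟨rfl, rfl⟩⟩
    · exact h
    · rwa [hzsym]
  · intro h
    exact ⟨p, q, h, Or.inl ⟨rfl, rfl⟩⟩

/-- The heavy pairs of a fractional matching form a matching. -/
lemma isMatching_heavyPairs {V : Type*} [Fintype V] [DecidableEq V] {z : V → V → ℝ}
    (hz0 : ∀ i j, 0 ≤ z i j) (hzsym : ∀ i j, z i j = z j i) (hzdiag : ∀ i, z i i = 0)
    (hzsum : ∀ i : V, ∑ j : V, z i j ≤ 1) : IsMatching (heavyPairs z) := by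
  constructor
  · intro p
    induction p using Sym2.ind with
    | _ x y =>
      rw [mk_mem_heavyPairs hzsym, Sym2.mk_isDiag_iff]
      rintro h rfl
      rw [hzdiag] at h
      norm_num at h
  · rintro p hp q hq v ⟨x, rfl⟩ ⟨y, rfl⟩
    rw [mk_mem_heavyPairs hzsym] at hp hq
    by_contra hne
    have hxy : x ≠ y := fun h => hne (by rw [h])
    have h : ∑ j ∈ {x, y}, z v j ≤ ∑ j, z v j :=
      Finset.sum_le_sum_of_subset_of_nonneg (Finset.subset_univ _) fun j _ _ => hz0 v j
    rw [Finset.sum_pair hxy] at h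
    linarith [hzsum v]

/-- Rounded routing: a demand between a heavy pair uses the direct reconfigurable link, any
other demand uses the given flow, rescaled to carry the demand exactly. -/
noncomputable def roundedFlow {V E : Type*} [Fintype V] [DecidableEq V] [Fintype E]
    [DecidableEq E] (src tgt : E → V) (D z : V → V → ℝ) (g : V → V → SLink V E → ℝ)
    (i j : V) : SLink V E → ℝ :=
  if 1 / 2 < z i j then fun a => if a = Sum.inr (i, j) then D i j else 0
  else fun a => D i j / netOut src tgt (g i j) i * g i j a

/-- deterministic rounding, Theorem `thm:SS_approximation` core:
from a feasible fractional solution `(lam, z, g)` of the LP relaxation of the MCRN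
mixed-integer program under splittable segregated routing, one obtains a matching
`M ⊆ ℰ` and a segregated splittable flow serving `D` in `N(M)` with congestion `≤ 2·lam`. -/
theorem lp_rounding_two_approx
    {V E : Type*} [Fintype V] [DecidableEq V] [Fintype E] [DecidableEq E]
    (src tgt : E → V) (c : SLink V E → ℝ) (hc : ∀ a, 0 < c a)
    (D : V → V → ℝ) (hD : ∀ i j, 0 ≤ D i j) (hDdiag : ∀ i, D i i = 0)
    (lam : ℝ) (hlam : 0 ≤ lam)
    (z : V → V → ℝ)
    (hz0 : ∀ i j, 0 ≤ z i j) (hz1 : ∀ i j, z i j ≤ 1)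
    (hzsym : ∀ i j, z i j = z j i) (hzdiag : ∀ i, z i i = 0)
    (hzsum : ∀ i : V, ∑ j : V, z i j ≤ 1)
    (hzcap : ∀ i j : V, i ≠ j → z i j * D i j ≤ lam * c (Sum.inr (i, j)))
    (g : V → V → SLink V E → ℝ)
    (hg0 : ∀ i j a, 0 ≤ g i j a)
    (hgstatic : ∀ i j p q, g i j (Sum.inr (p, q)) = 0)
    (hgcons : ∀ i j v, v ≠ i → v ≠ j → netOut src tgt (g i j) v = 0)
    (hgdem : ∀ i j : V, i ≠ j → (1 - z i j) * D i j ≤ netOut src tgt (g i j) i)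
    (hgload : ∀ (e : E) (b : Bool),
      totalFlow g (Sum.inl (e, b)) ≤ lam * c (Sum.inl (e, b))) :
    ∃ (M : Finset (Sym2 V)) (f : V → V → SLink V E → ℝ),
      IsMatching M ∧ IsFlow src tgt D M f ∧ Segregated D f ∧
        CongLE c M f (2 * lam) := by
  have hdouble : ∀ i j, i ≠ j → ¬ 1 / 2 < z i j → D i j ≤ 2 * netOut src tgt (g i j) i := by
    intro i j hij h
    nlinarith [hgdem i j hij, hD i j]
  have hscale0 : ∀ i j, ¬ 1 / 2 < z i j → 0 ≤ D i j / netOut src tgt (g i j) i := by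
    intro i j h
    by_cases hij : i = j
    · subst hij
      simp [hDdiag]
    · exact div_nonneg (hD i j) (by linarith [hdouble i j hij h, hD i j])
  have hscale2 : ∀ i j, ¬ 1 / 2 < z i j → D i j / netOut src tgt (g i j) i ≤ 2 := by
    intro i j h
    by_cases hij : i = j
    · subst hij
      simp [hDdiag]
    · have := hdouble i j hij h
      exact div_le_of_le_mul₀ (by linarith [hD i j]) (by norm_num) this
  refine ⟨heavyPairs z, roundedFlow src tgt D z g,
    isMatching_heavyPairs hz0 hzsym hzdiag hzsum, ?_, ?_, ?_, ?_⟩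
  · constructor
    · intro i j a
      unfold roundedFlow
      split_ifs with h
      · dsimp only
        split_ifs
        · exact hD i j
        · exact le_rfl
      · exact mul_nonneg (hscale0 i j h) (hg0 i j a)
    · intro i j p q hpq
      rw [mk_mem_heavyPairs hzsym] at hpq
      unfold roundedFlow
      split_ifs with h
      · refine if_neg fun he => hpq ?_
        simp only [Sum.inr.injEq, Prod.mk.injEq] at he
        rwa [he.1, he.2]
      · simp [hgstatic]
    · intro i a
      unfold roundedFlow
      split_ifs <;> simp [hDdiag]
    · intro i j v hi hj
      unfold roundedFlow
      split_ifs
      · simp [netOut_single, tl, hd, hi.symm, hj.symm]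
      · rw [netOut_const_mul, hgcons i j v hi hj, mul_zero]
    · intro i j hij
      unfold roundedFlow
      split_ifs with h
      · simp [netOut_single, tl, hd, hij.symm]
      · rw [netOut_const_mul]
        refine div_mul_cancel_of_imp fun h0 => ?_
        have := hdouble i j hij h
        rw [h0] at this
        linarith [hD i j]
  · intro i j _
    unfold roundedFlow
    split_ifs
    · exact Or.inl fun a ha => if_neg ha
    · exact Or.inr fun p q => by simp [hgstatic]
  · intro e b
    calc totalFlow (roundedFlow src tgt D z g) (Sum.inl (e, b))
        ≤ 2 * totalFlow g (Sum.inl (e, b)) := by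
          simp only [totalFlow, Finset.mul_sum]
          refine Finset.sum_le_sum fun i _ => Finset.sum_le_sum fun j _ => ?_
          unfold roundedFlow
          split_ifs with h
          · simpa using hg0 i j (Sum.inl (e, b))
          · exact mul_le_mul_of_nonneg_right (hscale2 i j h) (hg0 i j _)
      _ ≤ 2 * lam * c (Sum.inl (e, b)) := by linarith [hgload e b]
  · intro p q hpq
    rw [mk_mem_heavyPairs hzsym] at hpq
    have hne : p ≠ q := by
      rintro rfl
      rw [hzdiag] at hpq
      norm_num at hpq
    have hzero : ∀ i j, (i, j) ≠ (p, q) →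
        roundedFlow src tgt D z g i j (Sum.inr (p, q)) = 0 := by
      intro i j hij
      unfold roundedFlow
      split_ifs
      · exact if_neg fun he => hij (Sum.inr.inj he).symm
      · simp [hgstatic]
    have htotal : totalFlow (roundedFlow src tgt D z g) (Sum.inr (p, q)) = D p q := by
      rw [totalFlow, Finset.sum_eq_single p, Finset.sum_eq_single q]
      · simp only [roundedFlow, if_pos hpq, if_true]
      · exact fun j _ hj => hzero p j (by simp [hj])
      · simp
      · exact fun i _ hi => Finset.sum_eq_zero fun j _ => hzero i j (by simp [hi])
      · simp
    rw [htotal]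
    nlinarith [hzcap p q hne, hD p q]

end MCRN
end

section
/- Consider an instance (V,E,ℰ,c,D) of the min-congestion reconfigurable network problem under splittable and segregated routing in which all positive demands share a common source s, i.e., d_{i,j} > 0 implies v_i = s. Then for every matching M ⊆ ℰ and every segregated splittable flow f serving D in N(M) with congestion λ, there exists a matching M' ⊆ ℰ containing at most one reconfigurable link, that link (if any) being incident to s, and a segregated splittable flow serving D in N(M') with congestion at most λ. Hence an optimal reconfiguration can be chosen among the matchings consisting of at most one reconfigurable link incident to s. -/
open Finset

namespace MCRN

/-- Theorem `thm: tractable` core: under splittable segregated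
routing, if all positive demands share a common source `s`, then any reconfiguration
can be replaced by a matching with at most one reconfigurable link, that link being
incident to `s`, without increasing congestion. -/
theorem single_source_one_link
    {V E : Type*} [Fintype V] [DecidableEq V] [Fintype E] [DecidableEq E]
    (src tgt : E → V) (c : SLink V E → ℝ) (hc : ∀ a, 0 < c a)
    (D : V → V → ℝ) (hD : ∀ i j, 0 ≤ D i j) (hDdiag : ∀ i, D i i = 0)
    (s : V) (hsrc : ∀ i j, 0 < D i j → i = s)
    (M : Finset (Sym2 V)) (hM : IsMatching M)
    (f : V → V → SLink V E → ℝ) (lam : ℝ)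
    (hf : IsFlow src tgt D M f) (hseg : Segregated D f)
    (hcong : CongLE c M f lam) :
    ∃ (M' : Finset (Sym2 V)) (f' : V → V → SLink V E → ℝ),
      IsMatching M' ∧ M'.card ≤ 1 ∧ (∀ p ∈ M', s ∈ p) ∧
      IsFlow src tgt D M' f' ∧ Segregated D f' ∧ CongLE c M' f' lam := by
  classical
  have hcut : ∀ a, totalFlow (fun i j a => if 0 < D i j then f i j a else 0) a ≤
      totalFlow f a := fun a => Finset.sum_le_sum fun i _ => Finset.sum_le_sum fun j _ => by
    have := hf.nonneg i j a
    dsimp only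
    split_ifs <;> simp [this]
  have hzero : ∀ v, netOut src tgt (fun _ => (0 : ℝ)) v = 0 := fun v => by simp [netOut]
  refine ⟨M.filter (s ∈ ·), fun i j a => if 0 < D i j then f i j a else 0,
    ⟨fun p hp => hM.1 p (Finset.mem_filter.1 hp).1, fun p hp q hq =>
      hM.2 p (Finset.mem_filter.1 hp).1 q (Finset.mem_filter.1 hq).1⟩,
    ?_, fun p hp => (Finset.mem_filter.1 hp).2, ⟨?_, ?_, ?_, ?_, ?_⟩, ?_,
    fun e b => (hcut _).trans (hcong.1 e b),
    fun p q h => (hcut _).trans (hcong.2 p q (Finset.mem_filter.1 h).1)⟩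
  · refine Finset.card_le_one.2 fun p hp q hq => ?_
    rw [Finset.mem_filter] at hp hq
    exact hM.2 p hp.1 q hq.1 s hp.2 hq.2
  · intro i j a
    have := hf.nonneg i j a
    split_ifs <;> simp [this]
  · intro i j p q hpq
    by_cases h : 0 < D i j
    · simp only [h, if_true]
      rcases hseg i j h with hl | hl
      · by_cases he : (p, q) = (i, j)
        · obtain ⟨rfl, rfl⟩ := Prod.mk.inj he
          refine hf.supp _ _ _ _ fun hm => hpq (Finset.mem_filter.2 ⟨hm, ?_⟩)
          rw [← hsrc _ _ h]
          exact Sym2.mem_mk_left _ _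
        · exact hl _ fun h' => he (Sum.inr.inj h')
      · exact hl p q
    · simp only [h, if_false]
  · intro i a
    simp [hDdiag]
  · intro i j v hi hj
    by_cases h : 0 < D i j
    · simpa only [h, if_true] using hf.conserve i j v hi hj
    · simpa only [h, if_false] using hzero v
  · intro i j hij
    by_cases h : 0 < D i j
    · simpa only [h, if_true] using hf.demand i j hij
    · simpa only [h, if_false] using (hzero i).trans (le_antisymm (hD i j) (not_lt.1 h))
  · intro i j h
    simpa only [h, if_true] using hseg i j h

end MCRN
end

section
/- Let G_U=(U,E_U) be a 3-regular graph with U={u_1,…,u_n}, let k ≤ n be a positive integer, let ρ ∈ (1,2) be a real, and let I'=(V,E,ℰ,c,D) be the MCRN instance constructed from G_U and k as described. If every vertex cover of G_U has size at least ρ·k, then for every matching M ⊆ ℰ and every segregated splittable flow serving D in N(M), the congestion is at least min{ρ, 6/5}. -/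
open Finset

namespace MCRN
namespace APX

/-- Nodes of the APX-hardness instance built from a 3-regular graph on `Fin n` with
edge set `EU`: `v_i`, `a_i`, `b_i` (`i : Fin n`), `v_e`, `v'_e` (`e ∈ EU`), and `a`, `o`. -/
abbrev VN (n : ℕ) (EU : Finset (Sym2 (Fin n))) :=
  (Fin n ⊕ Fin n ⊕ Fin n) ⊕ ((↥EU ⊕ ↥EU) ⊕ (Unit ⊕ Unit))

def vN (n : ℕ) (EU : Finset (Sym2 (Fin n))) (i : Fin n) : VN n EU := .inl (.inl i)
def aN (n : ℕ) (EU : Finset (Sym2 (Fin n))) (i : Fin n) : VN n EU := .inl (.inr (.inl i))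
def bN (n : ℕ) (EU : Finset (Sym2 (Fin n))) (i : Fin n) : VN n EU := .inl (.inr (.inr i))
def veN (n : ℕ) (EU : Finset (Sym2 (Fin n))) (e : ↥EU) : VN n EU := .inr (.inl (.inl e))
def veN' (n : ℕ) (EU : Finset (Sym2 (Fin n))) (e : ↥EU) : VN n EU := .inr (.inl (.inr e))
def AN (n : ℕ) (EU : Finset (Sym2 (Fin n))) : VN n EU := .inr (.inr (.inl ()))
def ON (n : ℕ) (EU : Finset (Sym2 (Fin n))) : VN n EU := .inr (.inr (.inr ()))

/-- Incidences of the graph: a pair of an edge `e ∈ EU` and an endpoint `x ∈ e`. -/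
abbrev Inc (n : ℕ) (EU : Finset (Sym2 (Fin n))) := Σ e : ↥EU, {x : Fin n // x ∈ e.1}

/-- Static links of the APX-hardness instance: capacity-1 links `{v_x, v_e}`,
`{v'_e, b_x}` (for each incidence `(e, x)`) and `{v_e, v'_e}` (for each edge `e`);
capacity-3 links `{a_i, a}`, `{v_i, o}` (for each `i`) and `k` parallel `{a, o}` links. -/
abbrev EL (n k : ℕ) (EU : Finset (Sym2 (Fin n))) :=
  (Inc n EU ⊕ Inc n EU ⊕ ↥EU) ⊕ (Fin n ⊕ Fin n ⊕ Fin k)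

def Esrc (n k : ℕ) (EU : Finset (Sym2 (Fin n))) : EL n k EU → VN n EU
  | .inl (.inl s) => vN n EU s.2.1
  | .inl (.inr (.inl s)) => veN' n EU s.1
  | .inl (.inr (.inr e)) => veN n EU e
  | .inr (.inl i) => aN n EU i
  | .inr (.inr (.inl i)) => vN n EU i
  | .inr (.inr (.inr _)) => AN n EU

def Etgt (n k : ℕ) (EU : Finset (Sym2 (Fin n))) : EL n k EU → VN n EU
  | .inl (.inl s) => veN n EU s.1
  | .inl (.inr (.inl s)) => bN n EU s.2.1
  | .inl (.inr (.inr e)) => veN' n EU e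
  | .inr (.inl _) => AN n EU
  | .inr (.inr (.inl _)) => ON n EU
  | .inr (.inr (.inr _)) => ON n EU

/-- Capacities: `1` on both directions of the gadget links, `3` on both directions of
all other static links and of all reconfigurable links. -/
def capA (n k : ℕ) (EU : Finset (Sym2 (Fin n))) :
    SLink (VN n EU) (EL n k EU) → ℝ
  | .inl (.inl _, _) => 1
  | _ => 3

/-- Demands: `D(v_i, b_i) = 3` and `D(v_i, a_i) = 3` for each `i`; all others `0`. -/
def DA (n : ℕ) (EU : Finset (Sym2 (Fin n))) : VN n EU → VN n EU → ℝ
  | .inl (.inl i), .inl (.inr (.inl j)) => if i = j then 3 else 0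
  | .inl (.inl i), .inl (.inr (.inr j)) => if i = j then 3 else 0
  | _, _ => 0

/-- A vertex cover of the graph `(Fin n, EU)`. -/
def IsVC (n : ℕ) (EU : Finset (Sym2 (Fin n))) (C : Finset (Fin n)) : Prop :=
  ∀ e ∈ EU, ∃ x ∈ C, x ∈ e

end APX
end MCRN

namespace MCRN

section Cuts

variable {V E : Type*} [Fintype V] [DecidableEq V] [Fintype E]

/-- A positive demand without a reconfigurable link of its own is routed on static links. -/
theorem Segregated.static_of_notMem {src tgt : E → V} {D : V → V → ℝ} {M : Finset (Sym2 V)}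
    {f : V → V → SLink V E → ℝ} (hseg : Segregated D f) (hf : IsFlow src tgt D M f)
    {i j : V} (hD : 0 < D i j) (hM : s(i, j) ∉ M) (p q : V) :
    f i j (Sum.inr (p, q)) = 0 := by
  rcases hseg i j hD with h | h
  · have hzero : ∀ a, f i j a = 0 := by
      intro a
      by_cases ha : a = Sum.inr (i, j)
      · rw [ha]
        exact hf.supp i j i j hM
      · exact h a ha
    exact hzero _
  · exact h p q

/-- The net outflow of a set of nodes is the flow leaving it minus the flow entering it. -/
theorem sum_netOut (src tgt : E → V) (g : SLink V E → ℝ) (S : Finset V) :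
    ∑ v ∈ S, netOut src tgt g v =
      ∑ a : SLink V E,
        ((if tl src tgt a ∈ S then g a else 0) - if hd src tgt a ∈ S then g a else 0) := by
  simp only [netOut, Finset.sum_sub_distrib]
  congr 1 <;>
  · rw [Finset.sum_comm]
    simp

/-- A demand routed on static links is at most the flow on the static links leaving a set of
nodes that contains its source but not its sink. -/
theorem IsFlow.demand_le_sum_cut {src tgt : E → V} {D : V → V → ℝ} {M : Finset (Sym2 V)}
    {f : V → V → SLink V E → ℝ} (hf : IsFlow src tgt D M f) {i j : V}
    (hstatic : ∀ p q : V, f i j (Sum.inr (p, q)) = 0) {P : V → Prop} (hi : P i) (hj : ¬ P j)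
    {K : Finset (E × Bool)}
    (hK : ∀ x : E × Bool, P (tl src tgt (.inl x : SLink V E)) →
      ¬ P (hd src tgt (.inl x : SLink V E)) → x ∈ K) :
    D i j ≤ ∑ x ∈ K, f i j (Sum.inl x) := by
  classical
  have hij : i ≠ j := fun h => hj (h ▸ hi)
  have hsum : ∑ v ∈ univ.filter P, netOut src tgt (f i j) v = D i j := by
    rw [Finset.sum_eq_single_of_mem i (by simpa using hi), hf.demand i j hij]
    intro v hv hvi
    exact hf.conserve i j v hvi fun h => hj (h ▸ (Finset.mem_filter.1 hv).2)
  rw [← hsum, sum_netOut, Fintype.sum_sum_type]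
  have hinr : ∀ y : V × V, f i j (Sum.inr y) = 0 := fun y => hstatic y.1 y.2
  simp only [hinr, Finset.mem_filter, Finset.mem_univ, true_and, ite_self, sub_self,
    Finset.sum_const_zero, add_zero]
  rw [← Fintype.sum_ite_mem K]
  refine Finset.sum_le_sum fun x _ => ?_
  have h0 := hf.nonneg i j (.inl x)
  have hx := hK x
  split_ifs <;> first | linarith | tauto

/-- If a cut separates demands of total value at least `lam` times the capacity of the cut, then
some link of the cut has load at least `lam`. -/
theorem IsFlow.exists_load_ge_of_cut {src tgt : E → V} {D : V → V → ℝ} {M : Finset (Sym2 V)}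
    {f : V → V → SLink V E → ℝ} (hf : IsFlow src tgt D M f) (c : SLink V E → ℝ)
    {Q : Finset (V × V)} {P : V → Prop}
    (hQ : ∀ q ∈ Q, P q.1 ∧ ¬ P q.2 ∧ ∀ r t : V, f q.1 q.2 (Sum.inr (r, t)) = 0)
    {K : Finset (E × Bool)} (hne : K.Nonempty)
    (hK : ∀ x : E × Bool, P (tl src tgt (.inl x : SLink V E)) →
      ¬ P (hd src tgt (.inl x : SLink V E)) → x ∈ K)
    {lam : ℝ} (hlam : lam * ∑ x ∈ K, c (.inl x) ≤ ∑ q ∈ Q, D q.1 q.2) :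
    CongGE c M f lam := by
  have hle : ∑ x ∈ K, lam * c (.inl x) ≤ ∑ x ∈ K, totalFlow f (.inl x) := by
    rw [← Finset.mul_sum]
    refine hlam.trans ?_
    calc ∑ q ∈ Q, D q.1 q.2 ≤ ∑ q ∈ Q, ∑ x ∈ K, f q.1 q.2 (.inl x) :=
          Finset.sum_le_sum fun q hq =>
            hf.demand_le_sum_cut (hQ q hq).2.2 (hQ q hq).1 (hQ q hq).2.1 hK
      _ = ∑ x ∈ K, ∑ q ∈ Q, f q.1 q.2 (.inl x) := Finset.sum_comm
      _ ≤ ∑ x ∈ K, totalFlow f (.inl x) := by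
          refine Finset.sum_le_sum fun x _ => ?_
          rw [totalFlow, ← Fintype.sum_prod_type']
          exact Finset.sum_le_sum_of_subset_of_nonneg (Finset.subset_univ Q)
            fun q _ _ => hf.nonneg q.1 q.2 _
  obtain ⟨x, -, hx⟩ := Finset.exists_le_of_sum_le hne hle
  exact Or.inl ⟨x.1, x.2, hx⟩

end Cuts

namespace APX

variable {n k : ℕ} {EU : Finset (Sym2 (Fin n))}

theorem DA_vN_aN (i : Fin n) : DA n EU (vN n EU i) (aN n EU i) = 3 := by
  simp [DA, vN, aN]

theorem DA_vN_bN (i : Fin n) : DA n EU (vN n EU i) (bN n EU i) = 3 := by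
  simp [DA, vN, bN]

/-- If the demands `(v_i, a_i)` with `i ∈ C` are routed on static links, then the congestion is
at least `C.card / k`, as they all cross the `k` links between `a` and `o`. -/
theorem congGE_of_static_hub (hk : 0 < k) {M : Finset (Sym2 (VN n EU))}
    {f : VN n EU → VN n EU → SLink (VN n EU) (EL n k EU) → ℝ}
    (hf : IsFlow (Esrc n k EU) (Etgt n k EU) (DA n EU) M f) {C : Finset (Fin n)}
    (hC : ∀ i ∈ C, ∀ p q, f (vN n EU i) (aN n EU i) (.inr (p, q)) = 0)
    {lam : ℝ} (hlam : lam * k ≤ C.card) : CongGE (capA n k EU) M f lam := by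
  classical
  have : Nonempty (Fin k) := ⟨⟨0, hk⟩⟩
  have hinj : Function.Injective
      fun r : Fin k => ((.inr (.inr (.inr r)), false) : EL n k EU × Bool) := by
    intro r r' h
    simpa using h
  refine hf.exists_load_ge_of_cut _ (Q := C.image fun i => (vN n EU i, aN n EU i))
    (P := fun v => v ≠ AN n EU ∧ ∀ i, v ≠ aN n EU i) ?_
    (K := univ.image fun r : Fin k => (.inr (.inr (.inr r)), false))
    (univ_nonempty.image _) ?_ ?_
  · intro q hq
    obtain ⟨i, hi, rfl⟩ := Finset.mem_image.1 hq
    refine ⟨?_, ?_, hC i hi⟩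
    · simp [vN, aN, AN]
    · simp
  · rintro ⟨((s | s | e) | i | i | r), b⟩ <;> cases b <;>
      simp [tl, hd, Esrc, Etgt, vN, aN, bN, veN, veN', AN, ON]
  · rw [Finset.sum_image fun _ _ _ _ h => hinj h, Finset.sum_image]
    · simp only [DA_vN_aN, capA, Finset.sum_const, card_univ, Fintype.card_fin, nsmul_eq_mul]
      linarith
    · intro i _ j _ h
      simpa [vN, aN] using h

/-- In a 3-regular graph, at most two incidences at a node avoid a given edge at that node. -/
theorem card_inc_ne_le_two (hreg : ∀ v : Fin n, (EU.filter (fun e => v ∈ e)).card = 3)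
    (e : ↥EU) {x : Fin n} (hx : x ∈ e.1) :
    (univ.filter fun s : Inc n EU => s.2.1 = x ∧ s.1 ≠ e).card ≤ 2 := by
  have hcard : ((EU.filter (fun e => x ∈ e)).erase e.1).card = 2 := by
    rw [Finset.card_erase_of_mem (by simp [hx]), hreg]
  rw [← hcard]
  refine Finset.card_le_card_of_injOn (fun s => s.1.1) ?_ ?_
  · rintro ⟨e', y, hy⟩ hs
    simp only [coe_filter, mem_univ, true_and, Set.mem_ofPred_eq] at hs
    obtain ⟨rfl, hne⟩ := hs
    simp [hne, hy]
  · rintro ⟨⟨e₁, h₁⟩, y, hy⟩ hs ⟨⟨e₂, h₂⟩, z, hz⟩ ht h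
    simp only [coe_filter, mem_univ, true_and, Set.mem_ofPred_eq] at hs ht h
    obtain ⟨rfl, -⟩ := hs
    obtain ⟨rfl, -⟩ := ht
    subst h
    rfl

open Classical in
/-- The links entering the node set `{b_i, b_j, v'_e}` for an edge `e` with endpoints `i`, `j`. -/
noncomputable def edgeCut (n k : ℕ) (EU : Finset (Sym2 (Fin n))) (e : ↥EU) (i j : Fin n) :
    Finset (EL n k EU × Bool) :=
  insert (.inl (.inr (.inr e)), true)
    (((univ.filter fun s : Inc n EU => s.2.1 = i ∧ s.1 ≠ e) ∪
      univ.filter fun s : Inc n EU => s.2.1 = j ∧ s.1 ≠ e).image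
        fun s => (.inl (.inr (.inl s)), true))

theorem mem_edgeCut_of_inc {e : ↥EU} {i j : Fin n} {s : Inc n EU} (hs : s.2.1 = i ∨ s.2.1 = j)
    (hse : s.1 ≠ e) : (.inl (.inr (.inl s)), true) ∈ edgeCut n k EU e i j := by
  classical
  refine Finset.mem_insert_of_mem (Finset.mem_image_of_mem _ ?_)
  rw [← Finset.filter_or]
  simpa [hse] using hs

theorem card_edgeCut_le (hreg : ∀ v : Fin n, (EU.filter (fun e => v ∈ e)).card = 3)
    (e : ↥EU) {i j : Fin n} (hi : i ∈ e.1) (hj : j ∈ e.1) : (edgeCut n k EU e i j).card ≤ 5 := by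
  classical
  refine (Finset.card_insert_le _ _).trans (Nat.succ_le_succ (Finset.card_image_le.trans ?_))
  exact (Finset.card_union_le _ _).trans
    (Nat.add_le_add (card_inc_ne_le_two hreg e hi) (card_inc_ne_le_two hreg e hj))

theorem sum_capA_edgeCut (e : ↥EU) (i j : Fin n) :
    ∑ x ∈ edgeCut n k EU e i j, capA n k EU (.inl x) = (edgeCut n k EU e i j).card := by
  classical
  rw [Finset.sum_congr rfl (g := fun _ => (1 : ℝ)), Finset.sum_const, nsmul_one]
  intro x hx
  obtain rfl | hx := Finset.mem_insert.1 hx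
  · rfl
  · obtain ⟨s, -, rfl⟩ := Finset.mem_image.1 hx
    rfl

/-- If the demands `(v_i, b_i)` and `(v_j, b_j)` at the two endpoints of an edge are routed on
static links, then the congestion is at least `6/5`. -/
theorem congGE_of_static_edge (hreg : ∀ v : Fin n, (EU.filter (fun e => v ∈ e)).card = 3)
    {M : Finset (Sym2 (VN n EU))} {f : VN n EU → VN n EU → SLink (VN n EU) (EL n k EU) → ℝ}
    (hf : IsFlow (Esrc n k EU) (Etgt n k EU) (DA n EU) M f) (e : ↥EU) {i j : Fin n}
    (hij : i ≠ j) (he : e.1 = s(i, j))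
    (hi : ∀ p q, f (vN n EU i) (bN n EU i) (.inr (p, q)) = 0)
    (hj : ∀ p q, f (vN n EU j) (bN n EU j) (.inr (p, q)) = 0)
    {lam : ℝ} (hlam₀ : 0 ≤ lam) (hlam : lam ≤ 6 / 5) : CongGE (capA n k EU) M f lam := by
  classical
  refine hf.exists_load_ge_of_cut _
    (Q := {(vN n EU i, bN n EU i), (vN n EU j, bN n EU j)})
    (P := fun v => v ≠ bN n EU i ∧ v ≠ bN n EU j ∧ v ≠ veN' n EU e) ?_
    (K := edgeCut n k EU e i j)
    (Finset.insert_nonempty _ _) ?_ ?_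
  · intro q hq
    simp only [mem_insert, mem_singleton] at hq
    obtain rfl | rfl := hq
    · exact ⟨by simp [vN, bN, veN'], by simp, hi⟩
    · exact ⟨by simp [vN, bN, veN'], by simp, hj⟩
  · rintro ⟨((s | s | e') | i' | i' | r), _ | _⟩
    case inl.inr.inl.false =>
      obtain ⟨e', x, hx⟩ := s
      rintro ⟨hxi, hxj, -⟩ hhead
      have hee : e' = e := by
        simpa [hd, Esrc, bN, veN'] using hhead
      rw [hee, he, Sym2.mem_iff] at hx
      rcases hx with rfl | rfl
      · exact absurd rfl hxi
      · exact absurd rfl hxj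
    case inl.inr.inl.true =>
      rintro ⟨-, -, htail⟩ hhead
      refine mem_edgeCut_of_inc ?_ ?_
      · simpa [hd, Etgt, bN, veN', or_iff_not_imp_left] using hhead
      · simpa [tl, Esrc, veN'] using htail
    case inl.inr.inr.true =>
      rintro - hhead
      have hee : e' = e := by
        simpa [hd, Etgt, bN, veN'] using hhead
      rw [hee]
      exact Finset.mem_insert_self _ _
    all_goals simp [tl, hd, Esrc, Etgt, vN, aN, bN, veN, veN', AN, ON]
  · rw [sum_capA_edgeCut, Finset.sum_pair (by simp [vN, hij]), DA_vN_bN, DA_vN_bN]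
    have hcard : ((edgeCut n k EU e i j).card : ℝ) ≤ 5 := by
      exact_mod_cast card_edgeCut_le hreg e (by simp [he]) (by simp [he])
    linarith [mul_le_mul_of_nonneg_left hcard hlam₀]

end APX
end MCRN

namespace MCRN
open APX

/-- if every vertex cover of the 3-regular graph `(Fin n, EU)` has
size at least `ρ·k` (with `ρ ∈ (1,2)`), then in the constructed MCRN instance every
matching and segregated splittable flow serving the demands has congestion at least
`min ρ (6/5)`. -/
theorem apx_no_small_cover_implies_congestion_ge
    (n k : ℕ) (EU : Finset (Sym2 (Fin n)))
    (hk : 0 < k) (hkn : k ≤ n)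
    (hnd : ∀ e ∈ EU, ¬ e.IsDiag)
    (hreg : ∀ v : Fin n, (EU.filter (fun e => v ∈ e)).card = 3)
    (ρ : ℝ) (hρ1 : 1 < ρ) (hρ2 : ρ < 2)
    (hvc : ∀ C : Finset (Fin n), IsVC n EU C → ρ * (k : ℝ) ≤ (C.card : ℝ))
    (M : Finset (Sym2 (VN n EU)))
    (f : VN n EU → VN n EU → SLink (VN n EU) (EL n k EU) → ℝ)
    (hM : IsMatching M)
    (hf : IsFlow (Esrc n k EU) (Etgt n k EU) (DA n EU) M f)
    (hseg : Segregated (DA n EU) f) :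
    CongGE (capA n k EU) M f (min ρ (6 / 5)) := by
  classical
  set C : Finset (Fin n) := univ.filter fun i => s(vN n EU i, bN n EU i) ∈ M with hCdef
  by_cases hC : IsVC n EU C
  · refine congGE_of_static_hub hk hf (C := C) (fun i hi => ?_) ?_
    · refine hseg.static_of_notMem hf (by simp [DA_vN_aN]) fun ha => ?_
      have hb : s(vN n EU i, bN n EU i) ∈ M := (Finset.mem_filter.1 hi).2
      have h := hM.2 _ ha _ hb (vN n EU i) (by simp) (by simp)
      simp [vN, aN, bN] at h
    · exact (mul_le_mul_of_nonneg_right (min_le_left _ _) (Nat.cast_nonneg k)).trans (hvc C hC)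
  · simp only [IsVC, not_forall, not_exists, not_and] at hC
    obtain ⟨e, he, hCe⟩ := hC
    have hstatic : ∀ x ∈ e, ∀ p q, f (vN n EU x) (bN n EU x) (.inr (p, q)) = 0 := fun x hx =>
      hseg.static_of_notMem hf (by simp [DA_vN_bN])
        fun hb => hCe x (by simp [hCdef, hb]) hx
    induction e using Sym2.ind with
    | _ i j =>
      exact congGE_of_static_edge hreg hf ⟨s(i, j), he⟩ (by simpa using hnd _ he) rfl
        (hstatic i (by simp)) (hstatic j (by simp)) (le_min (by linarith) (by norm_num))
        (min_le_right _ _)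

end MCRN
end

section
/- Let G_U=(U,E_U) be a 3-regular graph with U={u_1,…,u_n}, let k ≤ n be a positive integer, and let I'=(V,E,ℰ,c,D) be the MCRN instance constructed from G_U and k as described. Let M ⊆ ℰ be any matching and set V* = { v_i : {v_i,b_i} ∈ M }. If the set { u_i : v_i ∈ V* } is not a vertex cover of G_U, then every segregated splittable flow serving D in N(M) has congestion at least 6/5. (Indeed, for an uncovered edge {u_i,u_j}, the 6 units of demand from v_i to b_i and from v_j to b_j must cross static links of total capacity at most 5.) -/
open Finset

namespace MCRN
open APX

/-- The value of a flow from `s` to `t` is at most the flow on the links entering a set of nodes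
that contains `t` but not `s`. -/
lemma le_sum_entering {V E : Type*} [Fintype V] [DecidableEq V] [Fintype E]
    (src tgt : E → V) (g : SLink V E → ℝ) (hg : ∀ a, 0 ≤ g a) (s t : V)
    (hcons : ∀ v, v ≠ s → v ≠ t → netOut src tgt g v = 0)
    (S : Finset V) (hs : s ∉ S) (ht : t ∈ S) :
    netOut src tgt g s ≤ ∑ a with tl src tgt a ∉ S ∧ hd src tgt a ∈ S, g a := by
  have hsum : ∑ v ∈ Sᶜ, netOut src tgt g v = netOut src tgt g s := by
    refine sum_eq_single s (fun v hv hvs => hcons v hvs ?_) (fun h => absurd hs (by simpa using h))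
    rintro rfl
    exact mem_compl.mp hv ht
  rw [← hsum]
  unfold netOut
  rw [sum_sub_distrib, sum_comm, sum_comm (s := Sᶜ), ← sum_sub_distrib, sum_filter]
  refine sum_le_sum fun a _ => ?_
  have := hg a
  by_cases h1 : tl src tgt a ∈ S <;> by_cases h2 : hd src tgt a ∈ S <;> simp [h1, h2, this]

/-- Two distinct commodities together contribute at most the total flow on a link. -/
lemma add_le_totalFlow {V E : Type*} [Fintype V] [DecidableEq V]
    (f : V → V → SLink V E → ℝ) (hf : ∀ i j a, 0 ≤ f i j a) {p q : V × V} (hpq : p ≠ q)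
    (a : SLink V E) : f p.1 p.2 a + f q.1 q.2 a ≤ totalFlow f a := by
  unfold totalFlow
  rw [← Fintype.sum_prod_type' (fun i j => f i j a), ← sum_pair (f := fun r => f r.1 r.2 a) hpq]
  exact sum_le_sum_of_subset_of_nonneg (subset_univ _) fun r _ _ => hf _ _ _

/-- A positive demand whose reconfigurable link is not in the matching avoids all
reconfigurable links in a segregated flow. -/
lemma Segregated.static {V E : Type*} [Fintype V] [DecidableEq V] [Fintype E]
    {src tgt : E → V} {D : V → V → ℝ} {M : Finset (Sym2 V)} {f : V → V → SLink V E → ℝ}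
    (hseg : Segregated D f) (hf : IsFlow src tgt D M f) {i j : V} (hD : 0 < D i j)
    (hM : s(i, j) ∉ M) (p q : V) : f i j (Sum.inr (p, q)) = 0 := by
  rcases hseg i j hD with h | h
  · have hzero : ∀ a, f i j a = 0 := fun a => by
      by_cases ha : a = Sum.inr (i, j)
      · exact ha ▸ hf.supp i j i j hM
      · exact h a ha
    exact hzero _
  · exact h p q

namespace APX

set_option synthInstance.maxSize 1000

/-- The sinks `b_i`, `b_j` together with the node `v'_e`. -/
def sinkSet {n : ℕ} {EU : Finset (Sym2 (Fin n))} (i j : Fin n) (e : ↥EU) : Finset (VN n EU) :=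
  {bN n EU i, bN n EU j, veN' n EU e}

/-- The static links entering `sinkSet i j e`. -/
def sinkCut {n : ℕ} (k : ℕ) {EU : Finset (Sym2 (Fin n))} (i j : Fin n) (e : ↥EU) :
    Finset (EL n k EU × Bool) :=
  {a | tl (Esrc n k EU) (Etgt n k EU) (Sum.inl a) ∉ sinkSet i j e ∧
    hd (Esrc n k EU) (Etgt n k EU) (Sum.inl a) ∈ sinkSet i j e}

/-- A static link entering `sinkSet i j e` is `v_e → v'_e`, or a link `v'_{e'} → b_x` with
`e' ≠ e` and `x` an endpoint of `e = {i, j}`. -/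
lemma mem_sinkCut {n k : ℕ} {EU : Finset (Sym2 (Fin n))} {i j : Fin n} {e : ↥EU}
    (he : e.1 = s(i, j)) {a : EL n k EU × Bool} (ha : a ∈ sinkCut k i j e) :
    a = (Sum.inl (Sum.inr (Sum.inr e)), true) ∨
      ∃ s : Inc n EU, a = (Sum.inl (Sum.inr (Sum.inl s)), true) ∧ s.1 ≠ e ∧
        (s.2.1 = i ∨ s.2.1 = j) := by
  obtain ⟨(s | s | e') | x | x | x, b⟩ := a <;> cases b <;>
    simp [sinkCut, sinkSet, tl, hd, Esrc, Etgt, vN, aN, bN, veN, veN', AN, ON] at ha ⊢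
  · obtain ⟨hne, hs⟩ := ha
    have hmem : s.2.1 ∈ s(i, j) := ((congrArg Subtype.val hs).trans he) ▸ s.2.2
    rw [Sym2.mem_iff] at hmem
    tauto
  · exact ha
  · exact ha

/-- At most five static links enter `sinkSet i j e`. -/
lemma card_sinkCut_le {n : ℕ} (k : ℕ) {EU : Finset (Sym2 (Fin n))} {i j : Fin n} {e : ↥EU}
    (he : e.1 = s(i, j)) (hreg : ∀ v : Fin n, (EU.filter (fun e => v ∈ e)).card = 3) :
    (sinkCut k i j e).card ≤ 5 := by
  let T : Finset (Fin n × Sym2 (Fin n)) :=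
    {i} ×ˢ EU.filter (fun e => i ∈ e) ∪ {j} ×ˢ (EU.filter (fun e => j ∈ e)).erase e.1
  let φ : EL n k EU × Bool → Fin n × Sym2 (Fin n) := fun a => match a.1 with
    | .inl (.inr (.inl s)) => (s.2.1, s.1.1)
    | _ => (i, e.1)
  have hT : T.card ≤ 5 := by
    refine (card_union_le _ _).trans ?_
    have hj : e.1 ∈ EU.filter (fun e => j ∈ e) := by simp [e.2, show j ∈ e.1 by simp [he]]
    rw [card_product, card_product, card_erase_of_mem hj, hreg, hreg]
    simp
  refine (card_le_card_of_injOn φ (t := T) (fun a ha => ?_) fun a ha a' ha' h => ?_).trans hT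
  · rcases mem_sinkCut he ha with rfl | ⟨⟨e', x, hx⟩, rfl, hne, rfl | rfl⟩
    · exact mem_union_left _ (by simp [φ, e.2, show i ∈ e.1 by simp [he]])
    · simp [T, φ, hx]
    · simp [T, φ, hx, Subtype.coe_ne_coe.mpr hne]
  · rcases mem_sinkCut he ha with rfl | ⟨⟨e₁, x, hx⟩, rfl, hne, -⟩ <;>
      rcases mem_sinkCut he ha' with rfl | ⟨⟨e₂, y, hy⟩, rfl, hne', -⟩
    · rfl
    · exact absurd (Subtype.ext (congrArg Prod.snd h).symm) hne'
    · exact absurd (Subtype.ext (congrArg Prod.snd h)) hne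
    · obtain rfl : e₁ = e₂ := Subtype.ext (congrArg Prod.snd h)
      obtain rfl : x = y := congrArg Prod.fst h
      rfl

/-- All links entering `sinkSet i j e` have capacity one. -/
lemma capA_of_mem_sinkCut {n k : ℕ} {EU : Finset (Sym2 (Fin n))} {i j : Fin n} {e : ↥EU}
    (he : e.1 = s(i, j)) {a : EL n k EU × Bool} (ha : a ∈ sinkCut k i j e) :
    capA n k EU (Sum.inl a) = 1 := by
  rcases mem_sinkCut he ha with rfl | ⟨s, rfl, -⟩ <;> rfl

/-- If `v_x` is not matched to `b_x`, the three units of demand from `v_x` to `b_x` enter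
`sinkSet i j e` on static links whenever `b_x` belongs to it. -/
lemma three_le_sum_sinkCut {n k : ℕ} {EU : Finset (Sym2 (Fin n))} {M : Finset (Sym2 (VN n EU))}
    {f : VN n EU → VN n EU → SLink (VN n EU) (EL n k EU) → ℝ}
    (hf : IsFlow (Esrc n k EU) (Etgt n k EU) (DA n EU) M f) (hseg : Segregated (DA n EU) f)
    {i j x : Fin n} {e : ↥EU} (hx : bN n EU x ∈ sinkSet i j e)
    (hM : s(vN n EU x, bN n EU x) ∉ M) :
    3 ≤ ∑ a ∈ sinkCut k i j e, f (vN n EU x) (bN n EU x) (Sum.inl a) := by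
  have hne : vN n EU x ≠ bN n EU x := by simp [vN, bN]
  have hD : DA n EU (vN n EU x) (bN n EU x) = 3 := by simp [DA, vN, bN]
  have hcut := le_sum_entering _ _ _ (hf.nonneg _ _) _ _ (hf.conserve (vN n EU x) (bN n EU x))
    (sinkSet i j e) (by simp [sinkSet, vN, bN, veN']) hx
  rw [hf.demand _ _ hne, hD, sum_filter, Fintype.sum_sum_type] at hcut
  simpa [sinkCut, sum_filter, hseg.static hf (by simp [hD]) hM] using hcut

end APX

/-- let `M` be any matching in the constructed MCRN instance and let
`V* = { v_i : {v_i, b_i} ∈ M }`. If `{ u_i : v_i ∈ V* }` is not a vertex cover of the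
3-regular graph `(Fin n, EU)`, then every segregated splittable flow serving the
demands in `N(M)` has congestion at least `6/5`. -/
theorem apx_not_cover_implies_congestion_ge
    (n k : ℕ) (EU : Finset (Sym2 (Fin n)))
    (hk : 0 < k) (hkn : k ≤ n)
    (hnd : ∀ e ∈ EU, ¬ e.IsDiag)
    (hreg : ∀ v : Fin n, (EU.filter (fun e => v ∈ e)).card = 3)
    (M : Finset (Sym2 (VN n EU))) (hM : IsMatching M)
    (hnotvc : ¬ ∀ e ∈ EU, ∃ x : Fin n, x ∈ e ∧ s(vN n EU x, bN n EU x) ∈ M)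
    (f : VN n EU → VN n EU → SLink (VN n EU) (EL n k EU) → ℝ)
    (hf : IsFlow (Esrc n k EU) (Etgt n k EU) (DA n EU) M f)
    (hseg : Segregated (DA n EU) f) :
    CongGE (capA n k EU) M f (6 / 5) := by
  push Not at hnotvc
  obtain ⟨e, he, hunc⟩ := hnotvc
  induction e with | h i j
  have hij : i ≠ j := by simpa using hnd _ he
  by_contra hcong
  have hlt : ∀ a ∈ sinkCut k i j ⟨s(i, j), he⟩, totalFlow f (Sum.inl a) < 6 / 5 := fun a ha => by
    have hcap := capA_of_mem_sinkCut rfl ha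
    by_contra! h
    exact hcong (Or.inl ⟨a.1, a.2, by simpa [hcap] using h⟩)
  have h6 : 6 ≤ ∑ a ∈ sinkCut k i j ⟨s(i, j), he⟩, totalFlow f (Sum.inl a) := by
    have hi := three_le_sum_sinkCut hf hseg (i := i) (j := j) (e := ⟨s(i, j), he⟩)
      (by simp [sinkSet]) (hunc i (by simp))
    have hj := three_le_sum_sinkCut hf hseg (i := i) (j := j) (e := ⟨s(i, j), he⟩)
      (by simp [sinkSet]) (hunc j (by simp))
    calc (6 : ℝ) ≤ _ := by linarith
      _ = _ := sum_add_distrib.symm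
      _ ≤ _ := sum_le_sum fun a _ => add_le_totalFlow f hf.nonneg
        (p := (vN n EU i, bN n EU i)) (q := (vN n EU j, bN n EU j)) (by simp [vN, hij]) _
  rcases (sinkCut k i j ⟨s(i, j), he⟩).eq_empty_or_nonempty with h | h
  · simp only [h, sum_empty] at h6
    norm_num at h6
  · have hsum := sum_lt_sum_of_nonempty h hlt
    have hcard : ((sinkCut k i j ⟨s(i, j), he⟩).card : ℝ) ≤ 5 := by
      exact_mod_cast card_sinkCut_le k rfl hreg
    rw [sum_const, nsmul_eq_mul] at hsum
    linarith

end MCRN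
end

section
/- Let G_U=(U,E_U) be a 3-regular graph with U={u_1,…,u_n}, let k ≤ n be a positive integer, let ε ∈ (0,1) be a real, and let I'=(V,E,ℰ,c,D) be the non-segregated MCRN instance constructed from G_U, k and ε as described. If G_U has a vertex cover of size at most k, then there exists a matching M ⊆ ℰ and an unsplittable (hence also a splittable) non-segregated flow serving D in N(M) whose congestion is at most 1. -/
open Finset

namespace MCRN
namespace NSeg

/-- Nodes of the non-segregated hardness instance built from a 3-regular graph on
`Fin n` with edge set `EU` and parameter `k`: `v_i` (`i : Fin n`), `a_j` (`j : Fin k`),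
`v_e` (`e ∈ EU`), and `t`. -/
abbrev VB (n k : ℕ) (EU : Finset (Sym2 (Fin n))) := (Fin n ⊕ Fin k) ⊕ (↥EU ⊕ Unit)

def vB (n k : ℕ) (EU : Finset (Sym2 (Fin n))) (i : Fin n) : VB n k EU := .inl (.inl i)
def aB (n k : ℕ) (EU : Finset (Sym2 (Fin n))) (j : Fin k) : VB n k EU := .inl (.inr j)
def veB (n k : ℕ) (EU : Finset (Sym2 (Fin n))) (e : ↥EU) : VB n k EU := .inr (.inl e)
def tB (n k : ℕ) (EU : Finset (Sym2 (Fin n))) : VB n k EU := .inr (.inr ())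

/-- Static links: `{v_x, v_e}` for each incidence `(e, x)`, `{a_j, t}` for each
`j : Fin k`, and the single extra link `e* = {v_2, a_k}`. -/
abbrev EB (n k : ℕ) (EU : Finset (Sym2 (Fin n))) :=
  (Σ e : ↥EU, {x : Fin n // x ∈ e.1}) ⊕ (Fin k ⊕ Unit)

def Bsrc (n k : ℕ) (EU : Finset (Sym2 (Fin n))) (hn : 1 < n) (hk : 0 < k) :
    EB n k EU → VB n k EU
  | .inl s => vB n k EU s.2.1
  | .inr (.inl j) => aB n k EU j
  | .inr (.inr _) => vB n k EU ⟨1, hn⟩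

def Btgt (n k : ℕ) (EU : Finset (Sym2 (Fin n))) (hn : 1 < n) (hk : 0 < k) :
    EB n k EU → VB n k EU
  | .inl s => veB n k EU s.1
  | .inr (.inl _) => tB n k EU
  | .inr (.inr _) => aB n k EU ⟨k - 1, Nat.sub_lt hk one_pos⟩

/-- Capacities: direction `(v_x, v_e)` has capacity `ε`, `(v_e, v_x)` capacity `1`;
direction `(a_j, t)` has capacity `1`, `(t, a_j)` capacity `ε`; `e*` has capacity `ε`
both ways; the reconfigurable direction `(v_i, a_j)` has capacity `1`, and every other
reconfigurable directed link has capacity `ε`. -/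
noncomputable def capB (n k : ℕ) (EU : Finset (Sym2 (Fin n))) (ε : ℝ) :
    SLink (VB n k EU) (EB n k EU) → ℝ
  | .inl (.inl _, b) => if b then ε else 1
  | .inl (.inr (.inl _), b) => if b then 1 else ε
  | .inl (.inr (.inr _), _) => ε
  | .inr (.inl (.inl _), .inl (.inr _)) => 1
  | .inr _ => ε

/-- Demands: `D(v_e, t) = 1/3` for every edge `e ∈ EU`; all other demands `0`. -/
noncomputable def DB (n k : ℕ) (EU : Finset (Sym2 (Fin n))) : VB n k EU → VB n k EU → ℝ
  | .inr (.inl _), .inr (.inr _) => 1 / 3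
  | _, _ => 0

/-- A vertex cover of the graph `(Fin n, EU)`. -/
def IsVC (n : ℕ) (EU : Finset (Sym2 (Fin n))) (C : Finset (Fin n)) : Prop :=
  ∀ e ∈ EU, ∃ x ∈ C, x ∈ e

end NSeg
end MCRN

namespace MCRN
open NSeg

noncomputable instance decidableMemLinkList {V E : Type*} (a : SLink V E) (P : List (SLink V E)) :
    Decidable (a ∈ P) :=
  Classical.propDecidable _

/-- The directed path `v_e → v_x → a_j → t`, for an endpoint `x` of `e`. -/
def coverPath (n k : ℕ) (EU : Finset (Sym2 (Fin n))) (e : ↥EU) (x : {x : Fin n // x ∈ e.1})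
    (j : Fin k) : List (SLink (VB n k EU) (EB n k EU)) :=
  [.inl (.inl ⟨e, x⟩, false), .inr (vB n k EU x, aB n k EU j), .inl (.inr (.inl j), true)]

/-- The flow sending each demand `D(v_e, t)` along the path `P e`. -/
noncomputable def pathFlow (n k : ℕ) (EU : Finset (Sym2 (Fin n)))
    (P : ↥EU → List (SLink (VB n k EU) (EB n k EU))) :
    VB n k EU → VB n k EU → SLink (VB n k EU) (EB n k EU) → ℝ
  | .inr (.inl e), .inr (.inr _) => fun a => if a ∈ P e then 1 / 3 else 0
  | _, _ => fun _ => 0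

lemma pathFlow_eq_zero_or {n k : ℕ} {EU : Finset (Sym2 (Fin n))}
    (P : ↥EU → List (SLink (VB n k EU) (EB n k EU))) (i j : VB n k EU) :
    (∃ e, i = veB n k EU e ∧ j = tB n k EU) ∨ (DB n k EU i j = 0 ∧ pathFlow n k EU P i j = 0) := by
  rcases i with (i | i) | (i | ⟨⟩) <;> rcases j with (j | j) | (j | ⟨⟩) <;>
    first
    | exact .inl ⟨_, rfl, rfl⟩
    | exact .inr ⟨rfl, rfl⟩

lemma pathFlow_ve_t {n k : ℕ} {EU : Finset (Sym2 (Fin n))}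
    (P : ↥EU → List (SLink (VB n k EU) (EB n k EU))) (e : ↥EU)
    (a : SLink (VB n k EU) (EB n k EU)) :
    pathFlow n k EU P (veB n k EU e) (tB n k EU) a = if a ∈ P e then 1 / 3 else 0 := rfl

lemma totalFlow_pathFlow {n k : ℕ} {EU : Finset (Sym2 (Fin n))}
    (P : ↥EU → List (SLink (VB n k EU) (EB n k EU))) (a : SLink (VB n k EU) (EB n k EU)) :
    totalFlow (pathFlow n k EU P) a = ((univ.filter fun e => a ∈ P e).card : ℝ) * (1 / 3) := by
  have : totalFlow (pathFlow n k EU P) a = ∑ e, if a ∈ P e then (1 / 3 : ℝ) else 0 := by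
    simp [totalFlow, Fintype.sum_sum_type, pathFlow]
  rw [this, ← Finset.sum_filter, Finset.sum_const, nsmul_eq_mul]

lemma netOut_indicator_list {V E : Type*} [Fintype V] [DecidableEq V] [Fintype E] [DecidableEq E]
    (src tgt : E → V) {P : List (SLink V E)} (hP : P.Nodup) (d : ℝ) (v : V) :
    netOut src tgt (fun a => if a ∈ P then d else 0) v =
      (P.map fun a => (if tl src tgt a = v then d else 0) -
        (if hd src tgt a = v then d else 0)).sum := by
  have hs : ∀ g : SLink V E → ℝ, (P.map g).sum = ∑ a, if a ∈ P then g a else 0 := fun g => by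
    rw [← List.sum_toFinset g hP, ← Finset.sum_filter]
    congr 1
    ext a
    simp
  rw [hs, netOut, ← Finset.sum_sub_distrib]
  refine Finset.sum_congr rfl fun a _ => ?_
  split_ifs <;> simp

lemma coverPath_nodup {n k : ℕ} {EU : Finset (Sym2 (Fin n))} (e : ↥EU)
    (x : {x : Fin n // x ∈ e.1}) (j : Fin k) : (coverPath n k EU e x j).Nodup := by
  simp [coverPath]

lemma isDiPath_coverPath {n k : ℕ} {EU : Finset (Sym2 (Fin n))} (hn : 1 < n) (hk : 0 < k)
    (e : ↥EU) (x : {x : Fin n // x ∈ e.1}) (j : Fin k) :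
    IsDiPath (Bsrc n k EU hn hk) (Btgt n k EU hn hk) (veB n k EU e) (tB n k EU)
      (coverPath n k EU e x j) := by
  refine ⟨by simp [coverPath], coverPath_nodup e x j, ?_, ?_, ?_⟩
  · change List.IsChain _ _
    simp [coverPath, tl, hd, Bsrc, Btgt]
  all_goals simp [coverPath, tl, hd, Btgt]

lemma netOut_coverPath {n k : ℕ} {EU : Finset (Sym2 (Fin n))} (hn : 1 < n) (hk : 0 < k)
    (e : ↥EU) (x : {x : Fin n // x ∈ e.1}) (j : Fin k) (v : VB n k EU) :
    netOut (Bsrc n k EU hn hk) (Btgt n k EU hn hk)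
      (fun a => if a ∈ coverPath n k EU e x j then 1 / 3 else 0) v =
      (if veB n k EU e = v then 1 / 3 else 0) - if tB n k EU = v then 1 / 3 else 0 := by
  rw [netOut_indicator_list _ _ (coverPath_nodup e x j)]
  let I : VB n k EU → ℝ := fun w => if w = v then 1 / 3 else 0
  change (I (veB n k EU e) - I (vB n k EU x)) + ((I (vB n k EU x) - I (aB n k EU j)) +
    ((I (aB n k EU j) - I (tB n k EU)) + 0)) = I (veB n k EU e) - I (tB n k EU)
  ring

lemma capB_pos {n k : ℕ} {EU : Finset (Sym2 (Fin n))} {ε : ℝ} (hε : 0 < ε)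
    (a : SLink (VB n k EU) (EB n k EU)) : 0 < capB n k EU ε a := by
  unfold capB
  split <;> (try split_ifs) <;> first | exact hε | exact one_pos

lemma capB_of_mem_coverPath {n k : ℕ} {EU : Finset (Sym2 (Fin n))} {ε : ℝ} {e : ↥EU}
    {x : {x : Fin n // x ∈ e.1}} {j : Fin k} {a : SLink (VB n k EU) (EB n k EU)}
    (h : a ∈ coverPath n k EU e x j) : capB n k EU ε a = 1 := by
  simp only [coverPath, List.mem_cons, List.not_mem_nil, or_false] at h
  rcases h with rfl | rfl | rfl <;> simp [capB, vB, aB]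

lemma eq_of_mem_coverPath {n k : ℕ} {EU : Finset (Sym2 (Fin n))} {C : Finset (Fin n)}
    {g : Fin n → Fin k} (hg : Set.InjOn g C) {x : (e : ↥EU) → {x : Fin n // x ∈ e.1}}
    (hx : ∀ e, (x e : Fin n) ∈ C) {e e' : ↥EU} {a : SLink (VB n k EU) (EB n k EU)}
    (h : a ∈ coverPath n k EU e (x e) (g (x e)))
    (h' : a ∈ coverPath n k EU e' (x e') (g (x e'))) : (x e : Fin n) = x e' := by
  simp only [coverPath, List.mem_cons, List.not_mem_nil, or_false] at h
  rcases h with rfl | rfl | rfl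
  · have : e = e' := by
      simp only [coverPath, List.mem_cons, List.not_mem_nil, or_false, reduceCtorEq, Sum.inl.injEq,
        Prod.mk.injEq, Sigma.mk.injEq, and_true, false_and] at h'
      exact h'.1
    rw [this]
  · simp only [coverPath, vB, aB, List.mem_cons, List.not_mem_nil, or_false, reduceCtorEq, false_or,
      Sum.inr.injEq, Sum.inl.injEq, Prod.mk.injEq] at h'
    exact h'.1
  · simp only [coverPath, List.mem_cons, List.not_mem_nil, or_false, reduceCtorEq, false_or,
      Sum.inr.injEq, Sum.inl.injEq, Prod.mk.injEq, and_true, false_and] at h'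
    exact hg (hx e) (hx e') h'

lemma totalFlow_pathFlow_coverPath_le {n k : ℕ} {EU : Finset (Sym2 (Fin n))}
    (hreg : ∀ v : Fin n, (EU.filter (fun e => v ∈ e)).card = 3) {ε : ℝ} (hε : 0 < ε)
    {C : Finset (Fin n)} {g : Fin n → Fin k} (hg : Set.InjOn g C)
    {x : (e : ↥EU) → {x : Fin n // x ∈ e.1}} (hx : ∀ e, (x e : Fin n) ∈ C)
    (a : SLink (VB n k EU) (EB n k EU)) :
    totalFlow (pathFlow n k EU fun e => coverPath n k EU e (x e) (g (x e))) a ≤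
      capB n k EU ε a := by
  rw [totalFlow_pathFlow]
  by_cases h : ∃ e, a ∈ coverPath n k EU e (x e) (g (x e))
  · obtain ⟨e₀, h₀⟩ := h
    rw [capB_of_mem_coverPath h₀]
    have hc : (univ.filter fun e => a ∈ coverPath n k EU e (x e) (g (x e))).card ≤ 3 := by
      rw [← hreg (x e₀)]
      refine Finset.card_le_card_of_injOn Subtype.val (fun e he => ?_)
        Subtype.val_injective.injOn
      have he' : a ∈ coverPath n k EU e (x e) (g (x e)) := by simpa using he
      have := (x e).2
      rw [eq_of_mem_coverPath hg hx he' h₀] at this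
      simpa using this
    have : ((univ.filter fun e => a ∈ coverPath n k EU e (x e) (g (x e))).card : ℝ) ≤ 3 := by
      exact_mod_cast hc
    linarith
  · push Not at h
    rw [Finset.filter_false_of_mem fun e _ => h e]
    simpa using (capB_pos hε a).le

lemma isMatching_image {n k : ℕ} {EU : Finset (Sym2 (Fin n))} {C : Finset (Fin n)}
    {g : Fin n → Fin k} (hg : Set.InjOn g C) :
    IsMatching (C.image fun y => s(vB n k EU y, aB n k EU (g y))) := by
  constructor
  · simp [vB, aB]
  · simp only [Finset.mem_image]
    rintro _ ⟨y, hy, rfl⟩ _ ⟨z, hz, rfl⟩ v hv hv'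
    suffices y = z by rw [this]
    rw [Sym2.mem_iff] at hv hv'
    rcases hv with rfl | rfl
    · simpa [vB, aB] using hv'
    · exact hg hy hz (by simpa [vB, aB] using hv')

lemma isFlow_pathFlow_coverPath {n k : ℕ} {EU : Finset (Sym2 (Fin n))} (hn : 1 < n) (hk : 0 < k)
    {C : Finset (Fin n)} (g : Fin n → Fin k)
    {x : (e : ↥EU) → {x : Fin n // x ∈ e.1}} (hx : ∀ e, (x e : Fin n) ∈ C) :
    IsFlow (Bsrc n k EU hn hk) (Btgt n k EU hn hk) (DB n k EU)
      (C.image fun y => s(vB n k EU y, aB n k EU (g y)))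
      (pathFlow n k EU fun e => coverPath n k EU e (x e) (g (x e))) := by
  set P := fun e => coverPath n k EU e (x e) (g (x e)) with hP
  have hnet : ∀ e v, netOut (Bsrc n k EU hn hk) (Btgt n k EU hn hk)
      (pathFlow n k EU P (veB n k EU e) (tB n k EU)) v =
      (if veB n k EU e = v then 1 / 3 else 0) - if tB n k EU = v then 1 / 3 else 0 :=
    fun e v => netOut_coverPath hn hk e (x e) (g (x e)) v
  constructor
  · intro i j a
    obtain ⟨e, rfl, rfl⟩ | ⟨-, h⟩ := pathFlow_eq_zero_or P i j
    · rw [pathFlow_ve_t]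
      split_ifs <;> norm_num
    · simp [h]
  · intro i j p q hpq
    obtain ⟨e, rfl, rfl⟩ | ⟨-, h⟩ := pathFlow_eq_zero_or P i j
    · rw [pathFlow_ve_t, if_neg]
      intro hmem
      simp only [hP, coverPath, List.mem_cons, List.not_mem_nil, or_false, reduceCtorEq, false_or,
        Sum.inr.injEq, Prod.mk.injEq] at hmem
      obtain ⟨rfl, rfl⟩ := hmem
      exact hpq (Finset.mem_image_of_mem _ (hx e))
    · simp [h]
  · intro i a
    obtain ⟨e, rfl, h⟩ | ⟨-, h⟩ := pathFlow_eq_zero_or P i i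
    · simp [veB, tB] at h
    · simp [h]
  · intro i j v hi hj
    obtain ⟨e, rfl, rfl⟩ | ⟨-, h⟩ := pathFlow_eq_zero_or P i j
    · rw [hnet, if_neg hi.symm, if_neg hj.symm, sub_zero]
    · simp [h, netOut]
  · intro i j hij
    obtain ⟨e, rfl, rfl⟩ | ⟨h0, h⟩ := pathFlow_eq_zero_or P i j
    · rw [hnet, if_pos rfl, if_neg hij.symm, sub_zero]
      rfl
    · simp [h, h0, netOut]

/-- if the 3-regular graph `(Fin n, EU)` has a vertex cover of size
at most `k`, then the constructed non-segregated MCRN instance admits a matching and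
an unsplittable (hence also splittable) non-segregated flow serving the demands with
congestion at most `1`. -/
theorem nseg_cover_implies_congestion_le_one
    (n k : ℕ) (EU : Finset (Sym2 (Fin n)))
    (hn : 1 < n) (hk : 0 < k) (hkn : k ≤ n)
    (hnd : ∀ e ∈ EU, ¬ e.IsDiag)
    (hreg : ∀ v : Fin n, (EU.filter (fun e => v ∈ e)).card = 3)
    (ε : ℝ) (hε0 : 0 < ε) (hε1 : ε < 1)
    (hvc : ∃ C : Finset (Fin n), IsVC n EU C ∧ C.card ≤ k) :
    ∃ (M : Finset (Sym2 (VB n k EU)))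
      (f : VB n k EU → VB n k EU → SLink (VB n k EU) (EB n k EU) → ℝ),
      IsMatching M ∧
      IsFlow (Bsrc n k EU hn hk) (Btgt n k EU hn hk) (DB n k EU) M f ∧
      Unsplittable (Bsrc n k EU hn hk) (Btgt n k EU hn hk) (DB n k EU) f ∧
      CongLE (capB n k EU ε) M f 1 := by
  obtain ⟨C, hC, hCk⟩ := hvc
  choose y hyC hye using hC
  let x : (e : ↥EU) → {x : Fin n // x ∈ e.1} := fun e => ⟨y e.1 e.2, hye e.1 e.2⟩
  have hx : ∀ e, (x e : Fin n) ∈ C := fun e => hyC e.1 e.2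
  have : Nonempty (Fin k) := ⟨⟨0, hk⟩⟩
  obtain ⟨g, -, hg⟩ : ∃ g : Fin n → Fin k, Set.MapsTo g C Set.univ ∧ Set.InjOn g C :=
    C.finite_toSet.exists_injOn_of_encard_le (t := (Set.univ : Set (Fin k))) (by simpa using hCk)
  have hcong := totalFlow_pathFlow_coverPath_le (ε := ε) hreg hε0 hg hx
  refine ⟨C.image fun y => s(vB n k EU y, aB n k EU (g y)),
    pathFlow n k EU fun e => coverPath n k EU e (x e) (g (x e)), isMatching_image hg,
    isFlow_pathFlow_coverPath hn hk g hx, fun i j hD => ?_,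
    fun e b => by simpa using hcong (.inl (e, b)), fun p q _ => by simpa using hcong (.inr (p, q))⟩
  obtain ⟨e, rfl, rfl⟩ | ⟨h, -⟩ :=
    pathFlow_eq_zero_or (fun e => coverPath n k EU e (x e) (g (x e))) i j
  · exact ⟨_, isDiPath_coverPath hn hk e (x e) (g (x e)), fun a ha => if_pos ha,
      fun a ha => if_neg ha⟩
  · exact absurd hD h.not_gt

end MCRN
end

section
/- Let I=(V,E,c,D) be an instance of the min-congestion multi-commodity unsplittable flow problem whose minimum capacity is 1, let α > 0, and let I'=(V',E',ℰ',c',D') be the MCRN instance constructed from I and α as described. For every matching M ⊆ ℰ' such that {v_i, v_{i'}} ∉ M for some v_i ∈ V, every segregated flow (splittable or unsplittable) serving D' in N(M) has congestion at least α. -/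
open Finset

namespace MCRN
namespace Red

/-- Static links of the constructed instance: the original links `E` together with one
new link `{v_i, v_i'}` for each original node. -/
def src2 {V E : Type*} (src : E → V) : E ⊕ V → V ⊕ V
  | .inl e => .inl (src e)
  | .inr v => .inl v

def tgt2 {V E : Type*} (tgt : E → V) : E ⊕ V → V ⊕ V
  | .inl e => .inl (tgt e)
  | .inr v => .inr v

/-- Capacities of the constructed instance: original static links keep their
capacities, the new static links `{v_i, v_i'}` have capacity `1` both ways, the
reconfigurable direction `(v_i, v_i')` has capacity `α`, and every other
reconfigurable directed link has capacity `1`. -/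
noncomputable def cap2 {V E : Type*} [DecidableEq V] (c : E → Bool → ℝ) (α : ℝ) :
    SLink (V ⊕ V) (E ⊕ V) → ℝ
  | .inl (.inl e, b) => c e b
  | .inl (.inr _, _) => 1
  | .inr (.inl v, .inr w) => if v = w then α else 1
  | .inr _ => 1

/-- Demands of the constructed instance: the original demands `D` together with a
demand `α` from `v_i` to `v_i'` for every original node. -/
noncomputable def D2 {V : Type*} [DecidableEq V] (D : V → V → ℝ) (α : ℝ) :
    V ⊕ V → V ⊕ V → ℝ
  | .inl i, .inl j => D i j
  | .inl i, .inr j => if i = j then α else 0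
  | _, _ => 0

/-- Capacities of the base instance, seen as a reconfigurable network with the empty
reconfiguration (reconfigurable capacities are irrelevant). -/
noncomputable def capBase {V E : Type*} (c : E → Bool → ℝ) : SLink V E → ℝ
  | .inl (e, b) => c e b
  | .inr _ => 1

end Red
end MCRN

namespace MCRN
open Red

/-- Net outflows sum to zero over all nodes. -/
theorem sum_netOut_s11 {V E : Type*} [Fintype V] [DecidableEq V] [Fintype E]
    (src tgt : E → V) (g : SLink V E → ℝ) : ∑ v, netOut src tgt g v = 0 := by
  unfold netOut
  rw [Finset.sum_sub_distrib, Finset.sum_comm, Finset.sum_comm (γ := V)]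
  simp

/-- The net inflow at the sink of a flow equals the demand. -/
theorem IsFlow.netOut_sink {V E : Type*} [Fintype V] [DecidableEq V] [Fintype E]
    [DecidableEq E] {src tgt : E → V} {D : V → V → ℝ} {M : Finset (Sym2 V)}
    {f : V → V → SLink V E → ℝ} (hf : IsFlow src tgt D M f) {i j : V} (hij : i ≠ j) :
    netOut src tgt (f i j) j = -D i j := by
  have hsum := sum_netOut_s11 src tgt (f i j)
  rw [Fintype.sum_eq_add i j hij fun v hv => hf.conserve i j v hv.1 hv.2,
    hf.demand i j hij] at hsum
  linarith

/-- The flow of a single commodity on a link is at most the total flow on that link. -/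
theorem le_totalFlow {V E : Type*} [Fintype V] {f : V → V → SLink V E → ℝ}
    (hf : ∀ i j a, 0 ≤ f i j a) (i j : V) (a : SLink V E) : f i j a ≤ totalFlow f a :=
  (Finset.single_le_sum (f := fun j => f i j a) (fun j _ => hf i j a)
    (Finset.mem_univ j)).trans
  (Finset.single_le_sum (f := fun i => ∑ j, f i j a)
    (fun i _ => Finset.sum_nonneg fun j _ => hf i j a) (Finset.mem_univ i))

/-- The only directed static link of the constructed instance entering the new node `v_i'`
is the one coming from `v_i`. -/
theorem hd_static_eq_pendant_iff {V E : Type*} (src tgt : E → V) (e : E ⊕ V) (b : Bool)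
    (v : V) :
    hd (src2 src) (tgt2 tgt) (.inl (e, b)) = .inr v ↔ e = .inr v ∧ b = true := by
  cases e <;> cases b <;> simp [hd, src2, tgt2]

/-- in the MCRN instance constructed from a min-congestion
multi-commodity unsplittable flow instance (minimum capacity `1`) and `α > 0`, every
matching `M` missing some pendant link `{v_i, v_i'}` forces every segregated flow
(splittable or unsplittable) serving the demands to have congestion at least `α`. -/
theorem reduction_missing_link_congestion
    {V E : Type*} [Fintype V] [DecidableEq V] [Fintype E] [DecidableEq E]
    (src tgt : E → V) (c : E → Bool → ℝ)
    (hc1 : ∀ e b, 1 ≤ c e b) (hcattain : ∃ e b, c e b = 1)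
    (D : V → V → ℝ) (hD : ∀ i j, 0 ≤ D i j) (hDdiag : ∀ i, D i i = 0)
    (α : ℝ) (hα : 0 < α)
    (M : Finset (Sym2 (V ⊕ V))) (hM : IsMatching M)
    (v : V) (hv : s((Sum.inl v : V ⊕ V), Sum.inr v) ∉ M)
    (f : (V ⊕ V) → (V ⊕ V) → SLink (V ⊕ V) (E ⊕ V) → ℝ)
    (hf : IsFlow (src2 src) (tgt2 tgt) (D2 D α) M f)
    (hseg : Segregated (D2 D α) f) :
    CongGE (cap2 c α) M f α := by
  have hne : (Sum.inl v : V ⊕ V) ≠ Sum.inr v := by simp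
  have hd2 : D2 D α (.inl v) (.inr v) = α := by simp [D2]
  have hsink := hf.netOut_sink hne
  have hstatic : ∀ p q, f (.inl v) (.inr v) (.inr (p, q)) = 0 := by
    rcases hseg (.inl v) (.inr v) (by rwa [hd2]) with h | h
    · intro p q
      by_cases hpq : (p, q) = (.inl v, .inr v)
      · rw [hpq]
        exact hf.supp _ _ _ _ hv
      · exact h _ (by simpa using hpq)
    · exact h
  have hin : (∑ a, if hd (src2 src) (tgt2 tgt) a = .inr v then f (.inl v) (.inr v) a else 0)
      = f (.inl v) (.inr v) (.inl (.inr v, true)) := by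
    rw [Fintype.sum_eq_single (.inl (.inr v, true))]
    · simp [hd_static_eq_pendant_iff]
    · rintro (⟨e, b⟩ | ⟨p, q⟩) ha
      · rw [if_neg]
        rw [hd_static_eq_pendant_iff]
        rintro ⟨rfl, rfl⟩
        exact ha rfl
      · simp [hstatic]
  have hout : 0 ≤ ∑ a, if tl (src2 src) (tgt2 tgt) a = .inr v
      then f (.inl v) (.inr v) a else 0 :=
    Finset.sum_nonneg fun a _ => by
      split_ifs
      exacts [hf.nonneg _ _ a, le_rfl]
  have hle := le_totalFlow hf.nonneg (.inl v) (.inr v) (.inl (.inr v, true))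
  rw [netOut, hin, hd2] at hsink
  refine .inl ⟨.inr v, true, ?_⟩
  simp only [cap2]
  linarith

end MCRN
end
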